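/- Let ρ*_1, τ*_1 ∈ 𝕋^a be arbitrary, and define for i = 1,2 the processes X^i_t := E_t[U^i(t, τ*_1(t))], Y^i_t := E_t[U^i(ρ*_1(t), t)], Z^i_t := U^i(t,t). Then for all α, β ∈ 𝒯^r and i = 1,2, u^i((α, ρ*_1), (β, τ*_1)) = ũ^i(α, β); i.e., the payoff of the original game under mixed type-A strategies built from α, β and the fixed adjustment maps ρ*_1, τ*_1 equals the payoff of the auxiliary randomized Dynkin game with payoff processes X^i, Y^i, Z^i. -/

import Mathlib

open MeasureTheory Set

section

variable {Ω : Type*} {m0 : MeasurableSpace Ω} (μ : Measure Ω) (𝓕 : Filtration ℕ m0) (T : ℕ)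

/-- `τ ∈ 𝒯`: a stopping time taking values in `{0,…,T}`. -/
def MemT (τ : Ω → ℕ) : Prop :=
  IsStoppingTime 𝓕 (fun ω => (τ ω : WithTop ℕ)) ∧ ∀ ω, τ ω ≤ T

/-- `τ ∈ 𝒯_{t+}`: a stopping time with `τ ≥ (t+1) ∧ T`. -/
def MemTgePlus (t : ℕ) (τ : Ω → ℕ) : Prop :=
  MemT 𝓕 T τ ∧ ∀ ω, min (t + 1) T ≤ τ ω

/-- `φ ∈ 𝕋^a`: an adjustment map with `φ(t,·) ∈ 𝒯_{t+}` for every stage `t`. -/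
def MemTTa (φ : ℕ → Ω → ℕ) : Prop :=
  ∀ t ≤ T, MemTgePlus 𝓕 T t (φ t)

/-- `α ∈ 𝒯^r`: a randomized stopping time, the randomization device being
`p ∈ [0,1]` (uniformly distributed). -/
def MemTr (α : ℝ → Ω → ℕ) : Prop :=
  Measurable (Function.uncurry α) ∧ ∀ p : ℝ, MemT 𝓕 T (α p)

/-- `ζ[η] = ζ₀ 1_{ζ₀ ≤ η₀} + ζ₁(η₀) 1_{ζ₀ > η₀}`. -/
def adjS (ζ0 : Ω → ℕ) (ζ1 : ℕ → Ω → ℕ) (η0 : Ω → ℕ) : Ω → ℕ :=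
  fun ω => if ζ0 ω ≤ η0 ω then ζ0 ω else ζ1 (η0 ω) ω

/-- `Γ(ζ,η) = E[U(ζ[η], η[ζ])]` for pure strategies `ζ = (ζ0,ζ1)`, `η = (η0,η1)`. -/
noncomputable def Gam (U : ℕ → ℕ → Ω → ℝ) (ζ0 : Ω → ℕ) (ζ1 : ℕ → Ω → ℕ)
    (η0 : Ω → ℕ) (η1 : ℕ → Ω → ℕ) : ℝ :=
  ∫ ω, U (adjS ζ0 ζ1 η0 ω) (adjS η0 η1 ζ0 ω) ω ∂μ

/-- `u(ρ,τ) = ∫∫ Γ((α(p,·),ρ₁),(β(q,·),τ₁)) dp dq` for mixed type-A strategies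
`ρ = (α,ρ₁)`, `τ = (β,τ₁)`. -/
noncomputable def uPay (U : ℕ → ℕ → Ω → ℝ) (α : ℝ → Ω → ℕ) (ρ1 : ℕ → Ω → ℕ)
    (β : ℝ → Ω → ℕ) (τ1 : ℕ → Ω → ℕ) : ℝ :=
  ∫ p in Icc (0:ℝ) 1, ∫ q in Icc (0:ℝ) 1, Gam μ U (α p) ρ1 (β q) τ1

/-- `X_t = E_t[U(t, τ₁(t))]`. -/
noncomputable def Xproc (U : ℕ → ℕ → Ω → ℝ) (τ1 : ℕ → Ω → ℕ) (t : ℕ) : Ω → ℝ :=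
  μ[fun ω => U t (τ1 t ω) ω | 𝓕 t]

/-- `Y_t = E_t[U(ρ₁(t), t)]`. -/
noncomputable def Yproc (U : ℕ → ℕ → Ω → ℝ) (ρ1 : ℕ → Ω → ℕ) (t : ℕ) : Ω → ℝ :=
  μ[fun ω => U (ρ1 t ω) t ω | 𝓕 t]

/-- `Z_t = U(t,t)`. -/
def Zproc (U : ℕ → ℕ → Ω → ℝ) (t : ℕ) : Ω → ℝ :=
  fun ω => U t t ω

/-- The payoff `ũ(α,β)` of the auxiliary Dynkin game with randomized stopping
times `α, β` and payoff processes `X, Y, Z`. -/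
noncomputable def utilde (X Y Z : ℕ → Ω → ℝ) (α β : ℝ → Ω → ℕ) : ℝ :=
  ∫ p in Icc (0:ℝ) 1, ∫ q in Icc (0:ℝ) 1, ∫ ω,
    ((if α p ω < β q ω then X (α p ω) ω else 0) +
     (if β q ω < α p ω then Y (β q ω) ω else 0) +
     (if α p ω = β q ω then Z (α p ω) ω else 0)) ∂μ

theorem aux_sum {Ω : Type*} {m0 : MeasurableSpace Ω} (μ : Measure Ω) [IsProbabilityMeasure μ]
    (𝓕 : Filtration ℕ m0) (T : ℕ) (A : ℕ → Set Ω) (f : ℕ → Ω → ℝ)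
    (hA : ∀ t, MeasurableSet[𝓕 t] (A t)) (hf : ∀ t ≤ T, Integrable (f t) μ) :
    Integrable (fun ω => ∑ t ∈ Finset.range (T + 1), (A t).indicator (f t) ω) μ ∧
    Integrable (fun ω => ∑ t ∈ Finset.range (T + 1), (A t).indicator (μ[f t | 𝓕 t]) ω) μ ∧
    ∫ ω, ∑ t ∈ Finset.range (T + 1), (A t).indicator (f t) ω ∂μ =
      ∫ ω, ∑ t ∈ Finset.range (T + 1), (A t).indicator (μ[f t | 𝓕 t]) ω ∂μ := by
  have hA' : ∀ t, MeasurableSet (A t) := fun t => 𝓕.le t _ (hA t)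
  have h1 : ∀ t ∈ Finset.range (T + 1), Integrable (fun ω => (A t).indicator (f t) ω) μ :=
    fun t ht => (hf t (by simpa [Nat.lt_succ_iff] using ht)).indicator (hA' t)
  have h2 : ∀ t ∈ Finset.range (T + 1),
      Integrable (fun ω => (A t).indicator (μ[f t | 𝓕 t]) ω) μ :=
    fun t _ => integrable_condExp.indicator (hA' t)
  refine ⟨integrable_finsetSum _ h1, integrable_finsetSum _ h2, ?_⟩
  rw [integral_finsetSum _ h1, integral_finsetSum _ h2]
  refine Finset.sum_congr rfl fun t ht => ?_
  rw [integral_indicator (hA' t), integral_indicator (hA' t),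
    setIntegral_condExp (𝓕.le t) (hf t (by simpa [Nat.lt_succ_iff] using ht)) (hA t)]

theorem aux_pick {Ω : Type*} (T : ℕ) (a : Ω → ℕ) (P : Ω → ℕ → Prop)
    [∀ ω t, Decidable (P ω t)] (g : ℕ → Ω → ℝ) (ω : Ω) (ha : a ω ≤ T) :
    ∑ t ∈ Finset.range (T + 1), ({ω | a ω = t ∧ P ω t} : Set Ω).indicator (g t) ω =
      if P ω (a ω) then g (a ω) ω else 0 := by
  classical
  rw [Finset.sum_eq_single (a ω)]
  · simp [Set.indicator_apply]
  · intro t _ ht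
    simp [ht.symm]
  · intro h
    exact absurd (Finset.mem_range.2 (Nat.lt_succ_of_le ha)) h

theorem aux_int {Ω : Type*} {m0 : MeasurableSpace Ω} (μ : Measure Ω) [IsProbabilityMeasure μ]
    (V : ℕ → Ω → ℝ) (hV : ∀ s, Measurable (V s)) (C : ℝ) (hC : ∀ s ω, |V s ω| ≤ C)
    (σ : Ω → ℕ) (hσ : Measurable σ) : Integrable (fun ω => V (σ ω) ω) μ := by
  have hm : Measurable (Function.uncurry V) := measurable_from_prod_countable_right hV
  refine Integrable.of_bound
    (hm.comp (hσ.prodMk measurable_id)).aestronglyMeasurable C (ae_of_all _ fun ω => ?_)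
  exact hC _ _

theorem aux_meas {Ω : Type*} {m0 : MeasurableSpace Ω} (𝓕 : Filtration ℕ m0) (T : ℕ)
    (σ : Ω → ℕ) (h : MemT 𝓕 T σ) : Measurable σ := by
  refine measurable_to_countable' fun t => ?_
  have := 𝓕.le t _ (h.1.measurableSet_eq t)
  simpa [Set.preimage] using this

theorem aux_add3 {Ω : Type*} {m0 : MeasurableSpace Ω} (μ : Measure Ω)
    {x x' y y' z : Ω → ℝ} (hx : Integrable x μ) (hx' : Integrable x' μ)
    (hy : Integrable y μ) (hy' : Integrable y' μ) (hz : Integrable z μ)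
    (h1 : ∫ ω, x ω ∂μ = ∫ ω, x' ω ∂μ) (h2 : ∫ ω, y ω ∂μ = ∫ ω, y' ω ∂μ) :
    ∫ ω, (x ω + y ω + z ω) ∂μ = ∫ ω, (x' ω + y' ω + z ω) ∂μ := by
  have e1 : Integrable (fun ω => x ω + y ω) μ := hx.add hy
  have e2 : Integrable (fun ω => x' ω + y' ω) μ := hx'.add hy'
  rw [integral_add e1 hz, integral_add e2 hz, integral_add hx hy, integral_add hx' hy', h1, h2]

theorem aux_gam {Ω : Type*} {m0 : MeasurableSpace Ω} (μ : Measure Ω) [IsProbabilityMeasure μ]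
    (𝓕 : Filtration ℕ m0) (T : ℕ) (U : ℕ → ℕ → Ω → ℝ)
    (hUm : ∀ s t, Measurable[𝓕 (max s t)] (U s t))
    (hUb : ∃ C, ∀ s t ω, |U s t ω| ≤ C)
    (ρ τ : ℕ → Ω → ℕ) (hρ : MemTTa 𝓕 T ρ) (hτ : MemTTa 𝓕 T τ)
    (a b : Ω → ℕ) (ha : MemT 𝓕 T a) (hb : MemT 𝓕 T b) :
    Gam μ U a ρ b τ = ∫ ω,
      ((if a ω < b ω then Xproc μ 𝓕 U τ (a ω) ω else 0) +
       (if b ω < a ω then Yproc μ 𝓕 U ρ (b ω) ω else 0) +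
       (if a ω = b ω then Zproc U (a ω) ω else 0)) ∂μ := by
  obtain ⟨C, hC⟩ := hUb
  have hU : ∀ s t, Measurable (U s t) := fun s t => (hUm s t).mono (𝓕.le _) le_rfl
  have eqm : ∀ c : Ω → ℕ, MemT 𝓕 T c → ∀ t, MeasurableSet[𝓕 t] {ω | c ω = t} := by
    intro c hc t
    simpa using hc.1.measurableSet_eq t
  have gtm : ∀ c : Ω → ℕ, MemT 𝓕 T c → ∀ t, MeasurableSet[𝓕 t] {ω | t < c ω} := by
    intro c hc t
    simpa using hc.1.measurableSet_gt t
  have X := aux_sum μ 𝓕 T (fun t => {ω | a ω = t ∧ t < b ω}) (fun t ω => U t (τ t ω) ω)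
    (fun t => (eqm a ha t).inter (gtm b hb t))
    (fun t ht => aux_int μ (U t) (hU t) C (hC t) _ (aux_meas 𝓕 T _ (hτ t ht).1))
  have Y := aux_sum μ 𝓕 T (fun t => {ω | b ω = t ∧ t < a ω}) (fun t ω => U (ρ t ω) t ω)
    (fun t => (eqm b hb t).inter (gtm a ha t))
    (fun t ht => aux_int μ (fun s => U s t) (fun s => hU s t) C (fun s => hC s t) _
      (aux_meas 𝓕 T _ (hρ t ht).1))
  have x1 := fun g ω => aux_pick T a (fun ω t => t < b ω) g ω (ha.2 ω)
  have y1 := fun g ω => aux_pick T b (fun ω t => t < a ω) g ω (hb.2 ω)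
  simp only [x1] at X
  simp only [y1] at Y
  have am := aux_meas 𝓕 T a ha
  have bm := aux_meas 𝓕 T b hb
  have Z : Integrable (fun ω => if a ω = b ω then Zproc U (a ω) ω else 0) μ := by
    have := (aux_int μ (fun s => U s s) (fun s => hU s s) C (fun s => hC s s) a am).indicator
      (measurableSet_eq_fun am bm)
    refine this.congr (ae_of_all _ fun ω => ?_)
    simp [Set.indicator_apply, Zproc]
  have key : ∀ ω, U (adjS a ρ b ω) (adjS b τ a ω) ω =
      (if a ω < b ω then U (a ω) (τ (a ω) ω) ω else 0) +
       (if b ω < a ω then U (ρ (b ω) ω) (b ω) ω else 0) +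
       (if a ω = b ω then Zproc U (a ω) ω else 0) := by
    intro ω
    rcases lt_trichotomy (a ω) (b ω) with h | h | h
    · simp [adjS, h, h.le, h.not_ge, h.not_gt, h.ne]
    · simp [adjS, h, Zproc]
    · simp [adjS, h, h.le, h.not_ge, h.not_gt, h.ne']
  unfold Gam Xproc Yproc
  simp only [key]
  exact aux_add3 μ X.1 X.2.1 Y.1 Y.2.1 Z X.2.2 Y.2.2

/-- for arbitrary adjustment maps `ρ₁*, τ₁* ∈ 𝕋^a` and arbitrary
randomized stopping times `α, β ∈ 𝒯^r`, the payoff of the original game under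
the mixed type-A strategies `(α,ρ₁*)`, `(β,τ₁*)` equals the payoff of the
auxiliary randomized Dynkin game with processes `Xⁱ, Yⁱ, Zⁱ`, for `i = 1,2`. -/
theorem uPay_eq_utilde
    [MeasurableSpace.CountablyGenerated Ω] [IsProbabilityMeasure μ]
    (U1 U2 : ℕ → ℕ → Ω → ℝ)
    (hU1m : ∀ s t, Measurable[𝓕 (max s t)] (U1 s t))
    (hU2m : ∀ s t, Measurable[𝓕 (max s t)] (U2 s t))
    (hU1b : ∃ C, ∀ s t ω, |U1 s t ω| ≤ C)
    (hU2b : ∃ C, ∀ s t ω, |U2 s t ω| ≤ C)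
    (ρ1s τ1s : ℕ → Ω → ℕ)
    (hρ1s : MemTTa 𝓕 T ρ1s) (hτ1s : MemTTa 𝓕 T τ1s)
    (α β : ℝ → Ω → ℕ) (hα : MemTr 𝓕 T α) (hβ : MemTr 𝓕 T β) :
    uPay μ U1 α ρ1s β τ1s =
      utilde μ (Xproc μ 𝓕 U1 τ1s) (Yproc μ 𝓕 U1 ρ1s) (Zproc U1) α β ∧
    uPay μ U2 α ρ1s β τ1s =
      utilde μ (Xproc μ 𝓕 U2 τ1s) (Yproc μ 𝓕 U2 ρ1s) (Zproc U2) α β := by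
  constructor
  · unfold uPay utilde
    simp only [aux_gam μ 𝓕 T U1 hU1m hU1b ρ1s τ1s hρ1s hτ1s _ _ (hα.2 _) (hβ.2 _)]
  · unfold uPay utilde
    simp only [aux_gam μ 𝓕 T U2 hU2m hU2b ρ1s τ1s hρ1s hτ1s _ _ (hα.2 _) (hβ.2 _)]

end
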